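/- Let θ ∈ C(ℝ^d) have modulus of continuity ω (concave, nondecreasing, ω(0)=0, C¹ on (0,∞)) and let α ∈ (0,1/2). Then (−Δ)^α θ has modulus of continuity ω̃(ξ) := C_{d,α}|𝕊^{d−1}| α^{−1} ∫₀^ξ ω'(η)/η^{2α} dη; i.e., |(−Δ)^α θ(x) − (−Δ)^α θ(z)| ≤ ω̃(|x−z|) for all x, z ∈ ℝ^d. -/

import Mathlib

open Real Set MeasureTheory

lemma stmt8_aux1 (α : ℝ) (hα : 0 < α) (hα2 : α < 1/2)
    (ω ω' : ℝ → ℝ) (K : ℝ)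
    (hωc : ContinuousOn ω (Set.Ici 0))
    (hω0 : ω 0 = 0)
    (hω' : ∀ η > (0:ℝ), HasDerivAt ω (ω' η) η)
    (h0 : ∀ η > (0:ℝ), 0 ≤ ω' η)
    (hpos : ∀ r, 0 ≤ r → 0 ≤ ω r)
    (hω'bd : ∀ η > (0:ℝ), ω' η ≤ K)
    (hlin : ∀ r, 0 ≤ r → ω r ≤ K * r) (ρ : ℝ) (hρ : 0 < ρ) :
    IntegrableOn (fun r => ω r * r ^ (-1 - 2 * α)) (Ioc 0 ρ) ∧
    ∫ r in Ioc 0 ρ, ω r * r ^ (-1 - 2 * α) =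
      (2 * α)⁻¹ * ((∫ η in Ioc 0 ρ, ω' η / η ^ (2 * α)) - ω ρ * ρ ^ (-2 * α)) := by
  have hbase : IntegrableOn (fun r : ℝ => K * r ^ (-2 * α)) (Ioc 0 ρ) := by
    have := (intervalIntegral.intervalIntegrable_rpow' (a := 0) (b := ρ) (r := -2 * α)
      (by linarith)).const_mul K
    rwa [intervalIntegrable_iff_integrableOn_Ioc_of_le hρ.le] at this
  have i1 : IntegrableOn (fun r => ω r * r ^ (-1 - 2 * α)) (Ioc 0 ρ) := by
    refine Integrable.mono' hbase ?_ ?_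
    · apply ContinuousOn.aestronglyMeasurable _ measurableSet_Ioc
      apply ContinuousOn.mul (hωc.mono fun x hx => hx.1.le)
      exact ContinuousOn.rpow_const continuousOn_id fun x hx => Or.inl hx.1.ne'
    · refine (ae_restrict_iff' measurableSet_Ioc).2 (Filter.Eventually.of_forall fun r hr => ?_)
      have hr0 : 0 < r := hr.1
      rw [Real.norm_of_nonneg (mul_nonneg (hpos r hr0.le) (rpow_nonneg hr0.le _))]
      calc ω r * r ^ (-1 - 2 * α) ≤ (K * r) * r ^ (-1 - 2 * α) :=
            mul_le_mul_of_nonneg_right (hlin r hr0.le) (rpow_nonneg hr0.le _)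
        _ = K * r ^ (-2 * α) := by
            rw [mul_assoc]
            congr 1
            nth_rewrite 1 [← rpow_one r]
            rw [← rpow_add hr0]
            congr 1
            ring
  have i2 : IntegrableOn (fun η => ω' η / η ^ (2 * α)) (Ioc 0 ρ) := by
    refine Integrable.mono' hbase ?_ ?_
    · have : AEStronglyMeasurable (fun η => deriv ω η / η ^ (2 * α))
          (volume.restrict (Ioc 0 ρ)) := by
        apply Measurable.aestronglyMeasurable
        exact (measurable_deriv ω).div (measurable_id.pow_const _)
      refine this.congr ?_
      refine (ae_restrict_iff' measurableSet_Ioc).2 (Filter.Eventually.of_forall fun r hr => ?_)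
      simp only [(hω' r hr.1).deriv]
    · refine (ae_restrict_iff' measurableSet_Ioc).2 (Filter.Eventually.of_forall fun r hr => ?_)
      have hr0 : 0 < r := hr.1
      rw [Real.norm_of_nonneg (div_nonneg (h0 r hr0) (rpow_nonneg hr0.le _))]
      rw [div_eq_mul_inv, ← rpow_neg hr0.le, ← neg_mul]
      exact mul_le_mul_of_nonneg_right (hω'bd r hr0) (rpow_nonneg hr0.le _)
  refine ⟨i1, ?_⟩
  have hcont : ContinuousOn (fun r => ω r * r ^ (-2 * α)) (Icc 0 ρ) := by
    intro r hr
    rcases hr.1.eq_or_lt with h | h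
    · subst h
      unfold ContinuousWithinAt
      simp only [hω0, zero_mul]
      have hup : Filter.Tendsto (fun r : ℝ => K * r ^ (1 - 2 * α)) (nhdsWithin 0 (Icc 0 ρ))
          (nhds 0) := by
        have : ContinuousAt (fun r : ℝ => K * r ^ (1 - 2 * α)) 0 :=
          continuousAt_const.mul (continuousAt_rpow_const _ _ (Or.inr (by linarith)))
        have h2 := this.tendsto
        simp only [zero_rpow (show (1 - 2 * α) ≠ 0 by linarith), mul_zero] at h2
        exact h2.mono_left nhdsWithin_le_nhds
      refine squeeze_zero' ?_ ?_ hup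
      · filter_upwards [self_mem_nhdsWithin] with r hr
        exact mul_nonneg (hpos r hr.1) (rpow_nonneg hr.1 _)
      · filter_upwards [self_mem_nhdsWithin] with r hr
        rcases hr.1.eq_or_lt with h | hr0
        · rw [← h, hω0, zero_rpow (show (1 - 2 * α) ≠ 0 by linarith)]; simp
        calc ω r * r ^ (-2 * α) ≤ (K * r) * r ^ (-2 * α) :=
              mul_le_mul_of_nonneg_right (hlin r hr0.le) (rpow_nonneg hr0.le _)
          _ = K * r ^ (1 - 2 * α) := by
              rw [mul_assoc]
              congr 1
              nth_rewrite 1 [← rpow_one r]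
              rw [← rpow_add hr0]
              congr 1
              ring
    · exact ((hω' r h).continuousAt.mul
        (continuousAt_rpow_const _ _ (Or.inl h.ne'))).continuousWithinAt
  have key := intervalIntegral.integral_eq_sub_of_hasDerivAt_of_le hρ.le hcont
    (f' := fun r => ω' r / r ^ (2 * α) - (2 * α) * (ω r * r ^ (-1 - 2 * α)))
    (by
      intro r hr
      have hr0 : 0 < r := hr.1
      have := (hω' r hr0).mul (Real.hasDerivAt_rpow_const (p := -2 * α) (Or.inl hr0.ne'))
      refine HasDerivAt.congr_deriv this ?_
      rw [div_eq_mul_inv, ← rpow_neg hr0.le, show -2 * α - 1 = -1 - 2 * α by ring,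
        ← neg_mul]
      ring)
    (by
      rw [intervalIntegrable_iff_integrableOn_Ioc_of_le hρ.le]
      exact i2.sub (i1.const_mul (2 * α)))
  rw [intervalIntegral.integral_of_le hρ.le, integral_sub i2 (i1.const_mul (2 * α)),
    integral_const_mul, hω0, zero_mul, sub_zero] at key
  rw [← key]
  field_simp
  ring

lemma stmt8_aux2 {d : ℕ} (hd : 0 < d) (α : ℝ) (hα : 0 < α) (hα2 : α < 1/2)
    (ω ω' : ℝ → ℝ) (K : ℝ)
    (hωc : ContinuousOn ω (Set.Ici 0))
    (hωmono : MonotoneOn ω (Set.Ici 0))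
    (hω0 : ω 0 = 0)
    (hω' : ∀ η > (0:ℝ), HasDerivAt ω (ω' η) η)
    (h0 : ∀ η > (0:ℝ), 0 ≤ ω' η)
    (hpos : ∀ r, 0 ≤ r → 0 ≤ ω r)
    (hω'bd : ∀ η > (0:ℝ), ω' η ≤ K)
    (hlin : ∀ r, 0 ≤ r → ω r ≤ K * r) (ρ : ℝ) (hρ : 0 < ρ) :
    IntegrableOn (fun r : ℝ => r ^ (d - 1) • (2 * min (ω r) (ω ρ) / r ^ ((d : ℝ) + 2 * α)))
      (Ioi 0) ∧
    ∫ r in Ioi (0 : ℝ), r ^ (d - 1) • (2 * min (ω r) (ω ρ) / r ^ ((d : ℝ) + 2 * α)) =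
      α⁻¹ * ∫ η in Ioc 0 ρ, ω' η / η ^ (2 * α) := by
  obtain ⟨i1, e1⟩ := stmt8_aux1 α hα hα2 ω ω' K hωc hω0 hω' h0 hpos hω'bd hlin ρ hρ
  have hpow : ∀ r : ℝ, 0 < r → ∀ c : ℝ,
      r ^ (d - 1) • (2 * c / r ^ ((d : ℝ) + 2 * α)) = 2 * (c * r ^ (-1 - 2 * α)) := by
    intro r hr c
    rw [smul_eq_mul, div_eq_mul_inv, ← rpow_neg hr.le, ← rpow_natCast, Nat.cast_sub hd,
      show -1 - 2 * α = ((d : ℝ) - (1 : ℕ)) + (-((d : ℝ) + 2 * α)) by push_cast; ring,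
      rpow_add hr]
    ring
  have c1 : EqOn (fun r : ℝ => r ^ (d - 1) • (2 * min (ω r) (ω ρ) / r ^ ((d : ℝ) + 2 * α)))
      (fun r => 2 * (ω r * r ^ (-1 - 2 * α))) (Ioc 0 ρ) := by
    intro r hr
    simp only
    rw [min_eq_left (hωmono hr.1.le hρ.le hr.2), hpow r hr.1]
  have c2 : EqOn (fun r : ℝ => r ^ (d - 1) • (2 * min (ω r) (ω ρ) / r ^ ((d : ℝ) + 2 * α)))
      (fun r => 2 * (ω ρ * r ^ (-1 - 2 * α))) (Ioi ρ) := by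
    intro r hr
    have hr' : ρ < r := hr
    simp only
    rw [min_eq_right (hωmono hρ.le (hρ.trans hr').le hr'.le), hpow r (hρ.trans hr')]
  have j1 := (integrableOn_congr_fun c1 measurableSet_Ioc).2 (i1.const_mul 2)
  have i2 : IntegrableOn (fun r : ℝ => 2 * (ω ρ * r ^ (-1 - 2 * α))) (Ioi ρ) :=
    ((integrableOn_Ioi_rpow_of_lt (by linarith) hρ).const_mul _).const_mul 2
  have j2 := (integrableOn_congr_fun c2 measurableSet_Ioi).2 i2
  rw [← Ioc_union_Ioi_eq_Ioi hρ.le]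
  refine ⟨j1.union j2, ?_⟩
  rw [setIntegral_union (Ioc_disjoint_Ioi le_rfl) measurableSet_Ioi j1 j2,
    setIntegral_congr_fun measurableSet_Ioc c1, setIntegral_congr_fun measurableSet_Ioi c2,
    integral_const_mul, e1, integral_const_mul, integral_const_mul,
    integral_Ioi_rpow_of_lt (by linarith) hρ, show -1 - 2 * α + 1 = -2 * α by ring]
  field_simp
  ring

/-- If θ ∈ C(ℝ^d) has modulus of continuity ω (concave, nondecreasing,
ω(0)=0, C¹ on (0,∞) with bounded derivative, so θ is Lipschitz) and α ∈ (0,1/2), then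
(−Δ)^α θ has modulus of continuity ω̃(ξ) = C_{d,α}|𝕊^{d−1}| α⁻¹ ∫₀^ξ ω'(η)/η^{2α} dη. -/
theorem stmt8 {d : ℕ} (hd : 0 < d) (α : ℝ) (hα : 0 < α) (hα2 : α < 1/2)
    (Cdα : ℝ) (hC : 0 < Cdα)
    (ω ω' : ℝ → ℝ) (K : ℝ)
    (hωc : ContinuousOn ω (Set.Ici 0))
    (hωmono : MonotoneOn ω (Set.Ici 0))
    (hωconc : ConcaveOn ℝ (Set.Ici 0) ω)
    (hω0 : ω 0 = 0)
    (hω' : ∀ η > (0:ℝ), HasDerivAt ω (ω' η) η)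
    (hω'bd : ∀ η > (0:ℝ), ω' η ≤ K)
    (θ : EuclideanSpace ℝ (Fin d) → ℝ) (hθcont : Continuous θ)
    (hmod : ∀ x y : EuclideanSpace ℝ (Fin d), |θ x - θ y| ≤ ω (dist x y)) :
    ∀ x z : EuclideanSpace ℝ (Fin d),
      |(Cdα * ∫ y : EuclideanSpace ℝ (Fin d),
            (θ x - θ (x - y)) / ‖y‖ ^ ((d : ℝ) + 2 * α)) -
        (Cdα * ∫ y : EuclideanSpace ℝ (Fin d),
            (θ z - θ (z - y)) / ‖y‖ ^ ((d : ℝ) + 2 * α))|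
      ≤ Cdα * ((d : ℝ) *
            (volume (Metric.ball (0 : EuclideanSpace ℝ (Fin d)) 1)).toReal) * α⁻¹ *
          ∫ η in Set.Ioc (0:ℝ) (dist x z), ω' η / η ^ (2 * α) := by
  intro x z
  have hpos : ∀ r, 0 ≤ r → 0 ≤ ω r := fun r hr => by
    have := hωmono (self_mem_Ici) (show r ∈ Ici (0:ℝ) from hr) hr
    rwa [hω0] at this
  have h0 : ∀ η > (0:ℝ), 0 ≤ ω' η := by
    intro η hη
    have h1 : derivWithin ω (Ici 0) η = ω' η :=
      ((hω' η hη).hasDerivWithinAt).derivWithin ((uniqueDiffOn_Ici 0) η hη.le)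
    rw [← h1]
    exact hωmono.derivWithin_nonneg
  have hlin : ∀ r, 0 ≤ r → ω r ≤ K * r := by
    intro r hr
    have := (convex_Ici (0:ℝ)).image_sub_le_mul_sub_of_deriv_le hωc
      (fun t ht => by
        rw [interior_Ici] at ht
        exact (hω' t ht).differentiableAt.differentiableWithinAt)
      (C := K) (fun t ht => by
        rw [interior_Ici] at ht
        rw [(hω' t ht).deriv]; exact hω'bd t ht) 0 self_mem_Ici r hr hr
    simpa [hω0] using this
  have hInn : 0 ≤ ∫ η in Set.Ioc (0:ℝ) (dist x z), ω' η / η ^ (2 * α) :=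
    setIntegral_nonneg measurableSet_Ioc fun η hη =>
      div_nonneg (h0 η hη.1) (rpow_nonneg hη.1.le _)
  have hR : 0 ≤ Cdα * ((d : ℝ) *
            (volume (Metric.ball (0 : EuclideanSpace ℝ (Fin d)) 1)).toReal) * α⁻¹ *
          ∫ η in Set.Ioc (0:ℝ) (dist x z), ω' η / η ^ (2 * α) := by positivity
  rcases eq_or_ne x z with hxz | hxz
  · subst hxz
    simpa using hR
  have hρ : 0 < dist x z := dist_pos.2 hxz
  set ρ := dist x z with hρdef
  haveI : Nonempty (Fin d) := ⟨⟨0, hd⟩⟩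
  haveI : Nontrivial (EuclideanSpace ℝ (Fin d)) := ⟨x, z, hxz⟩
  obtain ⟨gi, ge⟩ := stmt8_aux2 hd α hα hα2 ω ω' K hωc hωmono hω0 hω' h0 hpos hω'bd hlin ρ hρ
  set g : ℝ → ℝ := fun r => 2 * min (ω r) (ω ρ) / r ^ ((d : ℝ) + 2 * α) with hg
  have hdim : Module.finrank ℝ (EuclideanSpace ℝ (Fin d)) = d := by simp
  have gI : Integrable (fun y : EuclideanSpace ℝ (Fin d) => g ‖y‖) := by
    rw [integrable_fun_norm_addHaar, hdim]
    exact gi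
  have gE : ∫ y : EuclideanSpace ℝ (Fin d), g ‖y‖ =
      (d : ℝ) * (volume (Metric.ball (0 : EuclideanSpace ℝ (Fin d)) 1)).toReal *
        (α⁻¹ * ∫ η in Ioc 0 ρ, ω' η / η ^ (2 * α)) := by
    rw [integral_fun_norm_addHaar, hdim, ge]
    simp [Measure.real, mul_assoc]
  have hmeas : ∀ w : EuclideanSpace ℝ (Fin d), AEStronglyMeasurable
      (fun y : EuclideanSpace ℝ (Fin d) => (θ w - θ (w - y)) / ‖y‖ ^ ((d : ℝ) + 2 * α)) := by
    intro w
    apply Measurable.aestronglyMeasurable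
    apply Measurable.div
    · exact (continuous_const.sub (hθcont.comp (continuous_const.sub continuous_id))).measurable
    · exact measurable_norm.pow_const _
  have hbd : ∀ y : EuclideanSpace ℝ (Fin d),
      ‖(θ x - θ (x - y)) / ‖y‖ ^ ((d : ℝ) + 2 * α)
        - (θ z - θ (z - y)) / ‖y‖ ^ ((d : ℝ) + 2 * α)‖ ≤ g ‖y‖ := by
    intro y
    have hn : 0 ≤ ‖y‖ ^ ((d : ℝ) + 2 * α) := rpow_nonneg (norm_nonneg _) _
    rw [← sub_div, norm_div, Real.norm_of_nonneg hn, Real.norm_eq_abs]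
    refine div_le_div_of_nonneg_right ?_ hn
    have a1 := abs_le.1 (hmod x (x - y))
    have a2 := abs_le.1 (hmod z (z - y))
    have a3 := abs_le.1 (hmod x z)
    have a4 := abs_le.1 (hmod (x - y) (z - y))
    rw [dist_self_sub_right] at a1 a2
    rw [dist_sub_right] at a4
    rw [← hρdef] at a3 a4
    rcases min_cases (ω ‖y‖) (ω ρ) with h | h <;> rw [h.1, abs_le] <;>
      constructor <;> linarith [a1.1, a1.2, a2.1, a2.2, a3.1, a3.2, a4.1, a4.2]
  set F : EuclideanSpace ℝ (Fin d) → EuclideanSpace ℝ (Fin d) → ℝ :=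
    fun w y => (θ w - θ (w - y)) / ‖y‖ ^ ((d : ℝ) + 2 * α) with hF
  have hD : Integrable (fun y => F x y - F z y) :=
    Integrable.mono' gI ((hmeas x).sub (hmeas z)) (Filter.Eventually.of_forall hbd)
  rw [← mul_sub, abs_mul, abs_of_pos hC, mul_assoc Cdα, mul_assoc Cdα]
  by_cases hx : Integrable (F x)
  · have hz : Integrable (F z) := by
      have := hx.sub hD
      refine this.congr (Filter.Eventually.of_forall fun y => ?_)
      simp
    refine mul_le_mul_of_nonneg_left ?_ hC.le
    rw [mul_assoc _ α⁻¹, ← gE]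
    change |(∫ y, F x y) - ∫ y, F z y| ≤ _
    rw [← integral_sub hx hz, ← Real.norm_eq_abs]
    exact norm_integral_le_of_norm_le gI (Filter.Eventually.of_forall hbd)
  · have hz : ¬ Integrable (F z) := by
      intro hz
      apply hx
      refine (hD.add hz).congr (Filter.Eventually.of_forall fun y => ?_)
      simp
    have e1 : (∫ y, F x y) = 0 := integral_undef hx
    have e2 : (∫ y, F z y) = 0 := integral_undef hz
    change Cdα * |(∫ y, F x y) - ∫ y, F z y| ≤ _
    rw [e1, e2]
    simp only [sub_zero, abs_zero, mul_zero]
    positivity
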